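/- The limit of the value iteration sequence satisfies the Bellman equation: for the sequence defined by V^(0) = 0 and V^(k+1) = T(V^(k)), the pointwise limit V*(s) = sup_k V^(k)(s) is a fixed point of the Bellman operator, i.e., T(V*)(s) = V*(s) for every state s ∈ S. -/

import Mathlib

open Classical in
/-- The Bellman operator of the APT-DIFT game: `T V s = β` on defender-winning
absorbing states, `0` on adversary-winning absorbing states, and otherwise the
supremum over defender probability vectors of the minimum over adversary
actions of the expected next-state value. -/
noncomputable def bellmanT {S A D : Type*} [Fintype S] [Fintype A] [Fintype D]
    (β : ℝ) (WD WA : Set S) (P : S → A → D → S → ℝ) (V : S → ℝ) (s : S) : ℝ :=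
  if s ∈ WD then β
  else if s ∈ WA then 0
  else sSup ((fun p : D → ℝ => ⨅ a : A, ∑ d : D, ∑ s' : S, p d * P s a d s' * V s') ''
    {p : D → ℝ | (∀ d, 0 ≤ p d) ∧ ∑ d : D, p d = 1})

open Finset in
theorem expected_value_le_add {A D S : Type*} [Fintype S] [Fintype D]
    {P : A → D → S → ℝ} (hPnonneg : ∀ a d s', 0 ≤ P a d s')
    (hPsum : ∀ a d, ∑ s' : S, P a d s' = 1) {p : D → ℝ} (hp : ∀ d, 0 ≤ p d)
    (hp1 : ∑ d : D, p d = 1) {V W : S → ℝ} {ε : ℝ} (h : ∀ s', V s' ≤ W s' + ε) (a : A) :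
    ∑ d : D, ∑ s' : S, p d * P a d s' * V s' ≤
      (∑ d : D, ∑ s' : S, p d * P a d s' * W s') + ε := by
  calc ∑ d : D, ∑ s' : S, p d * P a d s' * V s'
      ≤ ∑ d : D, ∑ s' : S, p d * P a d s' * (W s' + ε) :=
        sum_le_sum fun d _ => sum_le_sum fun s' _ =>
          mul_le_mul_of_nonneg_left (h s') (mul_nonneg (hp d) (hPnonneg a d s'))
    _ = _ := by
        simp only [mul_add, sum_add_distrib, ← sum_mul, ← mul_sum, hPsum, mul_one, hp1, one_mul]

theorem iInf_expected_value_le_add {A D S : Type*} [Fintype S] [Fintype A] [Fintype D] [Nonempty A]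
    {P : A → D → S → ℝ} (hPnonneg : ∀ a d s', 0 ≤ P a d s')
    (hPsum : ∀ a d, ∑ s' : S, P a d s' = 1) {p : D → ℝ} (hp : ∀ d, 0 ≤ p d)
    (hp1 : ∑ d : D, p d = 1) {V W : S → ℝ} {ε : ℝ} (h : ∀ s', V s' ≤ W s' + ε) :
    (⨅ a : A, ∑ d : D, ∑ s' : S, p d * P a d s' * V s') ≤
      (⨅ a : A, ∑ d : D, ∑ s' : S, p d * P a d s' * W s') + ε := by
  rw [← sub_le_iff_le_add]
  refine le_ciInf fun a => sub_le_iff_le_add.2 ?_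
  exact (ciInf_le (Set.finite_range _).bddBelow a).trans
    (expected_value_le_add hPnonneg hPsum hp hp1 h a)

theorem iInf_expected_value_le {A D S : Type*} [Fintype S] [Fintype A] [Fintype D] [Nonempty A]
    {P : A → D → S → ℝ} (hPnonneg : ∀ a d s', 0 ≤ P a d s')
    (hPsum : ∀ a d, ∑ s' : S, P a d s' = 1) {p : D → ℝ} (hp : ∀ d, 0 ≤ p d)
    (hp1 : ∑ d : D, p d = 1) {V : S → ℝ} {c : ℝ} (h : ∀ s', V s' ≤ c) :
    (⨅ a : A, ∑ d : D, ∑ s' : S, p d * P a d s' * V s') ≤ c := by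
  simpa using iInf_expected_value_le_add (W := fun _ => 0) hPnonneg hPsum hp hp1
    (by simpa using h)

theorem nonempty_probability_vectors (D : Type*) [Fintype D] [Nonempty D] :
    {p : D → ℝ | (∀ d, 0 ≤ p d) ∧ ∑ d : D, p d = 1}.Nonempty := by
  classical
  obtain ⟨d⟩ := ‹Nonempty D›
  exact ⟨Pi.single d 1, fun e => by by_cases h : e = d <;> simp [h], by simp⟩

theorem bellmanT_zero_nonneg {S A D : Type*} [Fintype S] [Fintype A] [Fintype D]
    {β : ℝ} {WD WA : Set S} {P : S → A → D → S → ℝ} (hβ : 0 ≤ β) (s : S) :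
    0 ≤ bellmanT β WD WA P (fun _ => 0) s := by
  unfold bellmanT
  split_ifs
  · exact hβ
  · exact le_rfl
  · refine Real.sSup_nonneg ?_
    rintro _ ⟨p, -, rfl⟩
    simp

section Bellman

variable {S A D : Type*} [Fintype S] [Fintype A] [Fintype D] [Nonempty A] [Nonempty D]
  {β : ℝ} {WD WA : Set S} {P : S → A → D → S → ℝ}

theorem bellmanT_le_add (hPnonneg : ∀ s a d s', 0 ≤ P s a d s')
    (hPsum : ∀ s a d, ∑ s' : S, P s a d s' = 1) {V W : S → ℝ} {ε : ℝ} (hε : 0 ≤ ε)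
    (h : ∀ s', V s' ≤ W s' + ε) (s : S) :
    bellmanT β WD WA P V s ≤ bellmanT β WD WA P W s + ε := by
  unfold bellmanT
  split_ifs
  · linarith
  · linarith
  · refine csSup_le ((nonempty_probability_vectors D).image _) ?_
    rintro _ ⟨p, hp, rfl⟩
    refine (iInf_expected_value_le_add (hPnonneg s) (hPsum s) hp.1 hp.2 h).trans ?_
    gcongr
    refine le_csSup ?_ ⟨p, hp, rfl⟩
    obtain ⟨c, hc⟩ := (Set.finite_range W).bddAbove
    refine ⟨c, ?_⟩
    rintro _ ⟨q, hq, rfl⟩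
    exact iInf_expected_value_le (hPnonneg s) (hPsum s) hq.1 hq.2
      fun s' => hc (Set.mem_range_self s')

theorem bellmanT_mono (hPnonneg : ∀ s a d s', 0 ≤ P s a d s')
    (hPsum : ∀ s a d, ∑ s' : S, P s a d s' = 1) {V W : S → ℝ} (h : V ≤ W) :
    bellmanT β WD WA P V ≤ bellmanT β WD WA P W := fun s => by
  simpa using bellmanT_le_add hPnonneg hPsum le_rfl (fun s' => by simpa using h s') s

theorem bellmanT_le (hβ : 0 ≤ β) (hPnonneg : ∀ s a d s', 0 ≤ P s a d s')
    (hPsum : ∀ s a d, ∑ s' : S, P s a d s' = 1) {V : S → ℝ} (h : ∀ s', V s' ≤ β) (s : S) :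
    bellmanT β WD WA P V s ≤ β := by
  unfold bellmanT
  split_ifs
  · exact le_rfl
  · exact hβ
  · refine csSup_le ((nonempty_probability_vectors D).image _) ?_
    rintro _ ⟨p, hp, rfl⟩
    exact iInf_expected_value_le (hPnonneg s) (hPsum s) hp.1 hp.2 h

end Bellman


/-- The limit of the value iteration sequence satisfies the Bellman equation:
for the sequence `V 0 = 0`, `V (k+1) = T (V k)`, the pointwise limit
`V* s = ⨆ k, V k s` is a fixed point of the Bellman operator. -/
theorem value_iteration_limit_fixed_point {S A D : Type*} [Fintype S] [Fintype A] [Fintype D]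
    [Nonempty A] [Nonempty D]
    (β : ℝ) (hβ : 0 ≤ β) (WD WA : Set S) (hdisj : Disjoint WD WA)
    (P : S → A → D → S → ℝ)
    (hPnonneg : ∀ s a d s', 0 ≤ P s a d s')
    (hPsum : ∀ s a d, ∑ s' : S, P s a d s' = 1)
    (V : ℕ → S → ℝ)
    (hV0 : V 0 = fun _ => 0)
    (hVsucc : ∀ k, V (k + 1) = bellmanT β WD WA P (V k)) :
    ∀ s : S, bellmanT β WD WA P (fun s' => ⨆ k, V k s') s = ⨆ k, V k s := by
  have hmono : Monotone V := by
    refine monotone_nat_of_le_succ fun k => ?_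
    induction k with
    | zero =>
      rw [hVsucc 0, hV0]
      exact bellmanT_zero_nonneg hβ
    | succ k ih =>
      rw [hVsucc (k + 1), hVsucc k]
      exact bellmanT_mono hPnonneg hPsum (by rwa [← hVsucc k])
  have hle : ∀ k s, V k s ≤ β := by
    intro k
    induction k with
    | zero => simpa [hV0] using fun _ => hβ
    | succ k ih => rw [hVsucc k]; exact bellmanT_le hβ hPnonneg hPsum ih
  have hbdd : ∀ s, BddAbove (Set.range fun k => V k s) := fun s =>
    ⟨β, by rintro _ ⟨k, rfl⟩; exact hle k s⟩
  have hlim : ∀ s, Filter.Tendsto (fun k => V k s) Filter.atTop (nhds (⨆ k, V k s)) := fun s =>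
    tendsto_atTop_ciSup (fun _ _ hij => hmono hij s) (hbdd s)
  intro s
  apply le_antisymm
  · refine le_of_forall_pos_le_add fun ε hε => ?_
    have hev : ∀ᶠ k in Filter.atTop, ∀ s', (⨆ j, V j s') - ε < V k s' :=
      Filter.eventually_all.2 fun s' => (hlim s').eventually_const_lt (sub_lt_self _ hε)
    obtain ⟨k, hk⟩ := hev.exists
    calc bellmanT β WD WA P (fun s' => ⨆ j, V j s') s
        ≤ bellmanT β WD WA P (V k) s + ε :=
          bellmanT_le_add hPnonneg hPsum hε.le (fun s' => by linarith [hk s']) s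
      _ = V (k + 1) s + ε := by rw [hVsucc k]
      _ ≤ (⨆ j, V j s) + ε := by gcongr; exact le_ciSup (hbdd s) (k + 1)
  · refine ciSup_le fun k => (hmono k.le_succ s).trans ?_
    rw [Nat.succ_eq_add_one, hVsucc k]
    exact bellmanT_mono hPnonneg hPsum (fun s' => le_ciSup (hbdd s') k) s
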